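/- arXiv:1812.02355 — 2 statements merged into one kernel-verified Lean document; each statement's English description precedes it below -/
import Mathlib

section
/- Let a > 0, c > 0, m > 0 and T ∈ (0,∞]. Let y : [0,T) → ℝ be continuously differentiable with y(t) ≥ 0 for all t, and let w : [0,T) → ℝ be continuous with w(t) ≥ y(t)²/m for all t ∈ [0,T). Assume y'(t) = a·y(t) − c·w(t) for all t ∈ (0,T). Then, setting M := max(y(0), a·m/c), one has y(t) ≤ M for all t ∈ [0,T), and moreover ∫_{max(t−1,0)}^{t} w(s) ds ≤ (a+1)·M/c for all t ∈ (0,T). -/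
/-- ODE content of the basic mass estimate: if `y' = a y - c w` with `y ≥ 0` and
`w ≥ y²/m`, then `y ≤ M := max (y 0) (a m / c)` and the sliding-window integrals of
`w` are bounded by `(a+1) M / c`. -/
theorem stmt1 (a c m : ℝ) (ha : 0 < a) (hc : 0 < c) (hm : 0 < m)
    (T : EReal) (hT : 0 < T) (y w y' : ℝ → ℝ)
    (hy_deriv : ∀ t : ℝ, 0 ≤ t → (t : EReal) < T →
      HasDerivWithinAt y (y' t) {s : ℝ | 0 ≤ s ∧ (s : EReal) < T} t)
    (hy'_cont : ContinuousOn y' {t : ℝ | 0 ≤ t ∧ (t : EReal) < T})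
    (hy_nonneg : ∀ t : ℝ, 0 ≤ t → (t : EReal) < T → 0 ≤ y t)
    (hw_cont : ContinuousOn w {t : ℝ | 0 ≤ t ∧ (t : EReal) < T})
    (hw_lower : ∀ t : ℝ, 0 ≤ t → (t : EReal) < T → (y t) ^ 2 / m ≤ w t)
    (hode : ∀ t : ℝ, 0 < t → (t : EReal) < T → y' t = a * y t - c * w t) :
    (∀ t : ℝ, 0 ≤ t → (t : EReal) < T → y t ≤ max (y 0) (a * m / c)) ∧
    (∀ t : ℝ, 0 < t → (t : EReal) < T →
      ∫ s in Set.Ioc (max (t - 1) 0) t, w s ≤ (a + 1) * max (y 0) (a * m / c) / c) := by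
  have hsub : ∀ t : ℝ, (t : EReal) < T → Set.Icc 0 t ⊆ {s : ℝ | 0 ≤ s ∧ (s : EReal) < T} := by
    intro t ht s hs
    exact ⟨hs.1, lt_of_le_of_lt (EReal.coe_le_coe_iff.2 hs.2) ht⟩
  have hyc : ContinuousOn y {s : ℝ | 0 ≤ s ∧ (s : EReal) < T} :=
    fun s hs => (hy_deriv s hs.1 hs.2).continuousWithinAt
  have hright : ∀ t : ℝ, (t : EReal) < T → ∀ x ∈ Set.Ico 0 t,
      HasDerivWithinAt y (y' x) (Set.Ici x) x := by
    intro t ht x hx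
    have h1 := hy_deriv x hx.1 (hsub t ht ⟨hx.1, hx.2.le⟩).2
    refine h1.mono_of_mem_nhdsWithin ?_
    refine Filter.mem_of_superset (Icc_mem_nhdsGE hx.2) ?_
    intro s hs
    exact hsub t ht ⟨hx.1.trans hs.1, hs.2⟩
  set M := max (y 0) (a * m / c) with hM
  have hy0 : y 0 ≤ M := le_max_left _ _
  have hMm : a * m / c ≤ M := le_max_right _ _
  have hMpos : 0 < M := lt_of_lt_of_le (by positivity) hMm
  have part1 : ∀ t : ℝ, 0 ≤ t → (t : EReal) < T → y t ≤ M := by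
    intro t ht0 ht
    refine le_of_forall_pos_le_add fun ε hε => ?_
    refine image_le_of_deriv_right_lt_deriv_boundary (f := y) (f' := y') (a := 0) (b := t)
      (B := fun _ => M + ε) (B' := fun _ => 0) (hyc.mono (hsub t ht)) (hright t ht)
      (by linarith) (fun x => hasDerivAt_const x _) ?_ ⟨ht0, le_rfl⟩
    intro x hx hxe
    have hxT := (hsub t ht ⟨hx.1, hx.2.le⟩).2
    have hx0 : 0 < x := by
      rcases hx.1.eq_or_lt with h | h
      · subst h; linarith
      · exact h
    rw [hode x hx0 hxT]
    have h1 := hw_lower x hx.1 hxT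
    have h2 : a * m < c * y x := by
      rw [div_le_iff₀ hc] at hMm
      rw [hxe]; nlinarith
    have h3 : a * y x < c * (y x ^ 2 / m) := by
      rw [← mul_div_assoc, lt_div_iff₀ hm]
      have : 0 < y x := by linarith
      nlinarith
    have := mul_le_mul_of_nonneg_left h1 hc.le
    linarith
  refine ⟨part1, fun t ht0 ht => ?_⟩
  set r := max (t - 1) 0 with hr
  have hr0 : 0 ≤ r := le_max_right _ _
  have hr1 : t - 1 ≤ r := le_max_left _ _
  have hrt : r ≤ t := max_le (by linarith) ht0.le
  have hrs : Set.uIcc r t ⊆ {s : ℝ | 0 ≤ s ∧ (s : EReal) < T} := by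
    rw [Set.uIcc_of_le hrt]
    exact (Set.Icc_subset_Icc_left hr0).trans (hsub t ht)
  have hyi : IntervalIntegrable y MeasureTheory.volume r t := (hyc.mono hrs).intervalIntegrable
  have hwi : IntervalIntegrable w MeasureTheory.volume r t := (hw_cont.mono hrs).intervalIntegrable
  have ftc : ∫ s in r..t, (a * y s - c * w s) = y t - y r := by
    refine intervalIntegral.integral_eq_sub_of_hasDeriv_right (hyc.mono hrs) ?_
      ((hyi.const_mul a).sub (hwi.const_mul c))
    intro x hx
    rw [min_eq_left hrt, max_eq_right hrt] at hx
    have hx0 : 0 < x := lt_of_le_of_lt hr0 hx.1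
    rw [← hode x hx0 (hsub t ht ⟨hx0.le, hx.2.le⟩).2]
    exact (hright t ht x ⟨hx0.le, hx.2⟩).mono Set.Ioi_subset_Ici_self
  rw [intervalIntegral.integral_sub (hyi.const_mul a) (hwi.const_mul c),
    intervalIntegral.integral_const_mul, intervalIntegral.integral_const_mul] at ftc
  have hyb : ∫ s in r..t, y s ≤ ∫ s in r..t, M := by
    refine intervalIntegral.integral_mono_on hrt hyi (by simp) ?_
    intro x hx
    exact part1 x (hr0.trans hx.1) (hsub t ht ⟨hr0.trans hx.1, hx.2⟩).2
  rw [intervalIntegral.integral_const, smul_eq_mul] at hyb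
  rw [← intervalIntegral.integral_of_le hrt, le_div_iff₀ hc]
  have hyM : ∫ s in r..t, y s ≤ M := by nlinarith
  have h4 := mul_le_mul_of_nonneg_left hyM ha.le
  have h5 := hy_nonneg t ht0.le ht
  have h6 := part1 r hr0 (hrs Set.left_mem_uIcc).2
  linarith
end

section
/- Let χ > 0 and let a > 0 satisfy: a > χ²/4 in the case 0 < χ ≤ 2, and a > χ − 1 in the case χ > 2. Then there exists p ∈ (0,1) such that ((p+1)/2)·(√(1 + p·χ²) − 1) < a·p. -/
/-- Root-location fact: if `a > χ²/4` when `0 < χ ≤ 2` and `a > χ - 1` when `χ > 2`,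
then there is `p ∈ (0,1)` with `((p+1)/2)(√(1+pχ²) - 1) < a p`. -/
theorem stmt4 (a χ : ℝ) (ha : 0 < a) (hχ : 0 < χ)
    (h1 : χ ≤ 2 → χ ^ 2 / 4 < a) (h2 : 2 < χ → χ - 1 < a) :
    ∃ p : ℝ, 0 < p ∧ p < 1 ∧
      (p + 1) / 2 * (Real.sqrt (1 + p * χ ^ 2) - 1) < a * p := by
  rcases le_or_gt χ 2 with h | h
  · have hc := h1 h
    have hc0 : 0 < χ ^ 2 / 4 := by positivity
    obtain ⟨c, hcd⟩ : ∃ c, c = χ ^ 2 / 4 := ⟨_, rfl⟩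
    have hx : χ ^ 2 = 4 * c := by linarith
    rw [← hcd] at hc hc0
    rw [hx]
    have hs : 0 < a + c := by linarith
    have hp : 0 < (a - c) / (a + c) := div_pos (by linarith) hs
    have hp1 : (a - c) / (a + c) < 1 := by rw [div_lt_one hs]; linarith
    have hk : ((a - c) / (a + c) + 1) * c < a := by
      have : (a - c) / (a + c) + 1 = 2 * a / (a + c) := by field_simp; ring
      rw [this, div_mul_eq_mul_div, div_lt_iff₀ hs]
      nlinarith
    refine ⟨(a - c) / (a + c), hp, hp1, ?_⟩
    generalize (a - c) / (a + c) = p at *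
    have hq : Real.sqrt (1 + p * (4 * c)) ≤ 1 + 2 * (p * c) := by
      apply Real.sqrt_le_iff.mpr
      constructor
      · positivity
      · nlinarith [sq_nonneg (p * c)]
    calc (p + 1) / 2 * (Real.sqrt (1 + p * (4 * c)) - 1)
        ≤ (p + 1) / 2 * (2 * (p * c)) := by
          apply mul_le_mul_of_nonneg_left <;> linarith
      _ = ((p + 1) * c) * p := by ring
      _ < a * p := mul_lt_mul_of_pos_right hk hp
  · have hc := h2 h
    have hp : 0 < (χ - 2) / χ := div_pos (by linarith) hχ
    refine ⟨(χ - 2) / χ, hp, ?_, ?_⟩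
    · rw [div_lt_one hχ]; linarith
    · have e : 1 + (χ - 2) / χ * χ ^ 2 = (χ - 1) ^ 2 := by field_simp; ring
      rw [e, Real.sqrt_sq (by linarith)]
      have e2 : ((χ - 2) / χ + 1) / 2 * (χ - 1 - 1) = (χ - 1) * ((χ - 2) / χ) := by
        field_simp; ring
      rw [e2]
      exact mul_lt_mul_of_pos_right hc hp
end
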